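/- arXiv:0805.2444 — 14 statements merged into one kernel-verified Lean document; each statement's English description precedes it below -/
import Mathlib

section
/- Let I ⊆ ℝ be an open interval, α₂ ∈ ℂ, and let u : I → ℂ be four times differentiable on I and satisfy equation (1): u'''' = 10u(u')² + 10u²u'' − 6u⁵ + t·u + α₂ for all t ∈ I. Define q₁ := u, p₁ := u''' + (u')² − t/2 + (3u³ − 6uu' − 2u'')u, q₂ := u'' − 2uu', p₂ := u' − u². Then (q₁,p₁,q₂,p₂) is a solution of system (3) with the same parameter α₂: dq₁/dt = q₁² + p₂, dp₁/dt = −2q₁p₁ + α₂ − 1/2, dq₂/dt = −3p₂² + p₁ + t/2, dp₂/dt = q₂ on I. -/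
/-- `(q₁,p₁,q₂,p₂)` is a solution of system (3) with parameter `α₂` on `I ⊆ ℝ`:
`dq₁/dt = q₁² + p₂`, `dp₁/dt = −2q₁p₁ + α₂ − 1/2`,
`dq₂/dt = −3p₂² + p₁ + t/2`, `dp₂/dt = q₂`. -/
def IsSolSystem3 (I : Set ℝ) (α₂ : ℂ) (q₁ p₁ q₂ p₂ : ℝ → ℂ) : Prop :=
  ∀ t ∈ I,
    HasDerivAt q₁ ((q₁ t) ^ 2 + p₂ t) t ∧
    HasDerivAt p₁ (-2 * q₁ t * p₁ t + α₂ - 1 / 2) t ∧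
    HasDerivAt q₂ (-3 * (p₂ t) ^ 2 + p₁ t + (t : ℂ) / 2) t ∧
    HasDerivAt p₂ (q₂ t) t

/-- the birational transformation (2) takes a solution of the second member
of the second Painlevé hierarchy `P_II^(2)` (equation (1)) to a solution of system (3). -/
theorem stmt_0 (I : Set ℝ) (hIopen : IsOpen I) (hIconn : I.OrdConnected) (α₂ : ℂ)
    (u u1 u2 u3 u4 : ℝ → ℂ)
    (hd1 : ∀ t ∈ I, HasDerivAt u (u1 t) t)
    (hd2 : ∀ t ∈ I, HasDerivAt u1 (u2 t) t)
    (hd3 : ∀ t ∈ I, HasDerivAt u2 (u3 t) t)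
    (hd4 : ∀ t ∈ I, HasDerivAt u3 (u4 t) t)
    (heq : ∀ t ∈ I, u4 t =
      10 * u t * (u1 t) ^ 2 + 10 * (u t) ^ 2 * u2 t - 6 * (u t) ^ 5 + (t : ℂ) * u t + α₂) :
    IsSolSystem3 I α₂ u
      (fun t => u3 t + (u1 t) ^ 2 - (t : ℂ) / 2
        + (3 * (u t) ^ 3 - 6 * u t * u1 t - 2 * u2 t) * u t)
      (fun t => u2 t - 2 * u t * u1 t)
      (fun t => u1 t - (u t) ^ 2) := by
  intro t ht
  have h0 := hd1 t ht
  have h1 := hd2 t ht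
  have h2 := hd3 t ht
  have h3 := hd4 t ht
  have hid : HasDerivAt (fun s : ℝ => (s : ℂ)) 1 t := (hasDerivAt_id t).ofReal_comp
  refine ⟨h0.congr_deriv ?_,
    (((h3.fun_add (h1.fun_pow 2)).fun_sub (hid.div_const 2)).fun_add
      (((((h0.fun_pow 3).const_mul 3).fun_sub ((h0.const_mul 6).fun_mul h1)).fun_sub
        (h2.const_mul 2)).fun_mul h0)).congr_deriv ?_,
    (h2.fun_sub ((h0.const_mul 2).fun_mul h1)).congr_deriv ?_,
    (h1.fun_sub (h0.fun_pow 2)).congr_deriv ?_⟩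
  · ring
  · rw [heq t ht]
    push_cast
    ring
  · ring
  · push_cast
    ring
end

section
/- Let I ⊆ ℝ be an open interval, α₂ ∈ ℂ, and let (q₁,p₁,q₂,p₂) be a solution of system (3) on I with parameter α₂: dq₁/dt = q₁² + p₂, dp₁/dt = −2q₁p₁ + α₂ − 1/2, dq₂/dt = −3p₂² + p₁ + t/2, dp₂/dt = q₂. Then u := q₁ is four times differentiable on I and satisfies equation (1): u'''' = 10u(u')² + 10u²u'' − 6u⁵ + t·u + α₂ for all t ∈ I; moreover u' = q₁² + p₂, u'' − 2uu' = q₂, u' − u² = p₂ and u''' + (u')² − t/2 + (3u³ − 6uu' − 2u'')u = p₁ on I. -/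
/-- conversely, from a solution of system (3) the function `u := q₁` is
four times differentiable and solves equation (1), with the stated relations to
`p₁, q₂, p₂`. -/
theorem stmt_1 (I : Set ℝ) (hIopen : IsOpen I) (hIconn : I.OrdConnected) (α₂ : ℂ)
    (q₁ p₁ q₂ p₂ : ℝ → ℂ)
    (hsol : IsSolSystem3 I α₂ q₁ p₁ q₂ p₂) :
    ∃ u1 u2 u3 u4 : ℝ → ℂ,
      (∀ t ∈ I, HasDerivAt q₁ (u1 t) t) ∧
      (∀ t ∈ I, HasDerivAt u1 (u2 t) t) ∧
      (∀ t ∈ I, HasDerivAt u2 (u3 t) t) ∧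
      (∀ t ∈ I, HasDerivAt u3 (u4 t) t) ∧
      (∀ t ∈ I, u4 t =
        10 * q₁ t * (u1 t) ^ 2 + 10 * (q₁ t) ^ 2 * u2 t - 6 * (q₁ t) ^ 5
          + (t : ℂ) * q₁ t + α₂) ∧
      (∀ t ∈ I, u1 t = (q₁ t) ^ 2 + p₂ t) ∧
      (∀ t ∈ I, u2 t - 2 * q₁ t * u1 t = q₂ t) ∧
      (∀ t ∈ I, u1 t - (q₁ t) ^ 2 = p₂ t) ∧
      (∀ t ∈ I, u3 t + (u1 t) ^ 2 - (t : ℂ) / 2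
        + (3 * (q₁ t) ^ 3 - 6 * q₁ t * u1 t - 2 * u2 t) * q₁ t = p₁ t) := by
  refine ⟨fun t => q₁ t ^ 2 + p₂ t,
    fun t => 2 * q₁ t ^ 3 + 2 * q₁ t * p₂ t + q₂ t,
    fun t => 6 * q₁ t ^ 4 + 8 * q₁ t ^ 2 * p₂ t - p₂ t ^ 2 + 2 * q₁ t * q₂ t + p₁ t + (t : ℂ) / 2,
    fun t => 24 * q₁ t ^ 5 + 40 * q₁ t ^ 3 * p₂ t + 10 * q₁ t * p₂ t ^ 2 + 10 * q₁ t ^ 2 * q₂ t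
      + (t : ℂ) * q₁ t + α₂,
    fun t ht => (hsol t ht).1, fun t ht => ?_, fun t ht => ?_, fun t ht => ?_,
    fun t _ => by ring, fun t _ => by ring, fun t _ => by ring, fun t _ => by ring,
    fun t _ => by ring⟩
  all_goals obtain ⟨hq₁, hp₁, hq₂, hp₂⟩ := hsol t ht
  · refine ((hq₁.fun_pow 2).fun_add hp₂).congr_deriv ?_
    push_cast
    ring
  · refine ((((hq₁.fun_pow 3).const_mul 2).fun_add
      ((hq₁.const_mul 2).fun_mul hp₂)).fun_add hq₂).congr_deriv ?_
    push_cast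
    ring
  · have hid : HasDerivAt (fun s : ℝ => (s : ℂ) / 2) (1 / 2) t :=
      (HasDerivAt.ofReal_comp (hasDerivAt_id t)).div_const 2 |>.congr_deriv (by simp)
    refine (((((((hq₁.fun_pow 4).const_mul 6).fun_add
      (((hq₁.fun_pow 2).const_mul 8).fun_mul hp₂)).fun_sub (hp₂.fun_pow 2)).fun_add
      ((hq₁.const_mul 2).fun_mul hq₂)).fun_add hp₁).fun_add hid).congr_deriv ?_
    push_cast
    ring
end

section
/- Let I ⊆ ℝ be an open interval, α₂ ∈ ℂ, and let (q₁,p₁,q₂,p₂) be a solution of system (3) on I with parameter α₂ such that p₁(t) ≠ 0 for all t ∈ I. Define u(t) := H(q₁(t),p₁(t),q₂(t),p₂(t),t) = q₁²p₁ + (1/2 − α₂)q₁ − p₂³ + (t/2)p₂ − q₂²/2 + p₁p₂. Then u is five times differentiable on I, one has 48(u')² + 8u''' − 2t = 4p₁ ≠ 0 on I, and u satisfies the fifth-order equation (5): u''''' = [(1−α₂)α₂ − 2u'(24(u')² − t)² − 24u''(u' − t·u'') + 8u'''(5u'(t − 24(u')²) − 12(u'')² − 16u'u''') + 2u''''(48u'u''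 + 2u'''' − 1)] / (48(u')² + 8u''' − 2t) for all t ∈ I. -/
/-- the Hamiltonian `H` of a solution of system (3) with nonvanishing `p₁`
is five times differentiable and satisfies the fifth-order equation (5). -/
theorem stmt_2 (I : Set ℝ) (hIopen : IsOpen I) (hIconn : I.OrdConnected) (α₂ : ℂ)
    (q₁ p₁ q₂ p₂ : ℝ → ℂ)
    (hsol : IsSolSystem3 I α₂ q₁ p₁ q₂ p₂)
    (hp₁ : ∀ t ∈ I, p₁ t ≠ 0)
    (u : ℝ → ℂ)
    (hu : ∀ t, u t = (q₁ t) ^ 2 * p₁ t + (1 / 2 - α₂) * q₁ t - (p₂ t) ^ 3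
      + (t : ℂ) / 2 * p₂ t - (q₂ t) ^ 2 / 2 + p₁ t * p₂ t) :
    ∃ u1 u2 u3 u4 u5 : ℝ → ℂ,
      (∀ t ∈ I, HasDerivAt u (u1 t) t) ∧
      (∀ t ∈ I, HasDerivAt u1 (u2 t) t) ∧
      (∀ t ∈ I, HasDerivAt u2 (u3 t) t) ∧
      (∀ t ∈ I, HasDerivAt u3 (u4 t) t) ∧
      (∀ t ∈ I, HasDerivAt u4 (u5 t) t) ∧
      (∀ t ∈ I, 48 * (u1 t) ^ 2 + 8 * u3 t - 2 * (t : ℂ) = 4 * p₁ t) ∧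
      (∀ t ∈ I, 48 * (u1 t) ^ 2 + 8 * u3 t - 2 * (t : ℂ) ≠ 0) ∧
      (∀ t ∈ I, u5 t =
        ((1 - α₂) * α₂ - 2 * u1 t * (24 * (u1 t) ^ 2 - (t : ℂ)) ^ 2
          - 24 * u2 t * (u1 t - (t : ℂ) * u2 t)
          + 8 * u3 t * (5 * u1 t * ((t : ℂ) - 24 * (u1 t) ^ 2)
            - 12 * (u2 t) ^ 2 - 16 * u1 t * u3 t)
          + 2 * u4 t * (48 * u1 t * u2 t + 2 * u4 t - 1))
        / (48 * (u1 t) ^ 2 + 8 * u3 t - 2 * (t : ℂ))) := by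
  have hid : ∀ t : ℝ, HasDerivAt (fun s : ℝ => (s : ℂ)) 1 t := fun t => by
    simpa using (hasDerivAt_id t).ofReal_comp
  obtain rfl : u = fun t => (q₁ t) ^ 2 * p₁ t + (1 / 2 - α₂) * q₁ t - (p₂ t) ^ 3
      + (t : ℂ) / 2 * p₂ t - (q₂ t) ^ 2 / 2 + p₁ t * p₂ t := funext hu
  refine ⟨fun t => p₂ t / 2, fun t => q₂ t / 2,
    fun t => (-3 * (p₂ t) ^ 2 + p₁ t + (t : ℂ) / 2) / 2,
    fun t => (-6 * (p₂ t * q₂ t) - 2 * (q₁ t * p₁ t) + α₂) / 2,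
    fun t => (-6 * ((q₂ t) ^ 2 + p₂ t * (-3 * (p₂ t) ^ 2 + p₁ t + (t : ℂ) / 2))
      - 2 * (((q₁ t) ^ 2 + p₂ t) * p₁ t
        + q₁ t * (-2 * q₁ t * p₁ t + α₂ - 1 / 2))) / 2, ?_, ?_, ?_, ?_, ?_, ?_, ?_, ?_⟩
  · intro t ht
    obtain ⟨hq₁, hp₁', hq₂, hp₂⟩ := hsol t ht
    refine (((((((hq₁.pow 2).mul hp₁').add (hq₁.const_mul (1 / 2 - α₂))).sub (hp₂.pow 3)).add
      (((hid t).div_const 2).mul hp₂)).sub ((hq₂.pow 2).div_const 2)).add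
      (hp₁'.mul hp₂)).congr_deriv ?_
    simp only [Pi.pow_apply]
    push_cast
    ring
  · exact fun t ht => (hsol t ht).2.2.2.div_const 2
  · exact fun t ht => (hsol t ht).2.2.1.div_const 2
  · intro t ht
    obtain ⟨-, hp₁', -, hp₂⟩ := hsol t ht
    refine (((((hp₂.pow 2).const_mul (-3)).add hp₁').add
      ((hid t).div_const 2)).div_const 2).congr_deriv ?_
    push_cast
    ring
  · intro t ht
    obtain ⟨hq₁, hp₁', hq₂, hp₂⟩ := hsol t ht
    refine (((((hp₂.mul hq₂).const_mul (-6)).sub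
      ((hq₁.mul hp₁').const_mul 2)).add_const α₂).div_const 2).congr_deriv ?_
    ring
  · intro t _
    ring
  · intro t ht h
    exact hp₁ t ht (by linear_combination h / 4)
  · intro t ht
    have hden : 48 * (p₂ t / 2) ^ 2 + 8 * ((-3 * (p₂ t) ^ 2 + p₁ t + (t : ℂ) / 2) / 2)
        - 2 * (t : ℂ) = 4 * p₁ t := by ring
    simp only [hden]
    rw [eq_div_iff (mul_ne_zero (by norm_num) (hp₁ t ht))]
    ring
end

section
/- Let I ⊆ ℝ be an open interval, α₂ ∈ ℂ, and let u : I → ℂ be five times differentiable, satisfy equation (5), and suppose w(t) := u''' + 6(u')² − t/4 is nonvanishing on I. Define x := u, y := u', z := u'', w := u''' + 6(u')² − t/4, q := (u'''' − (α₂ − 24u'u'')/2)/w. Then (x,y,z,w,q) is a solution of system (6) on I with the same parameter α₂: dx/dt = y, dy/dt = z, dz/dt = −6y² + w + t/4, dw/dt = wq + (2α₂ − 1)/4, dq/dt = −q²/2 − 4y. -/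
/-- `(x,y,z,w,q)` is a solution of system (6) with parameter `α₂` on `I ⊆ ℝ`:
`dx/dt = y`, `dy/dt = z`, `dz/dt = −6y² + w + t/4`,
`dw/dt = wq + (2α₂ − 1)/4`, `dq/dt = −q²/2 − 4y`. -/
def IsSolSystem6 (I : Set ℝ) (α₂ : ℂ) (x y z w q : ℝ → ℂ) : Prop :=
  ∀ t ∈ I,
    HasDerivAt x (y t) t ∧
    HasDerivAt y (z t) t ∧
    HasDerivAt z (-6 * (y t) ^ 2 + w t + (t : ℂ) / 4) t ∧
    HasDerivAt w (w t * q t + (2 * α₂ - 1) / 4) t ∧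
    HasDerivAt q (-(q t) ^ 2 / 2 - 4 * y t) t

/-- the birational transformation of Theorem 9.1 takes a solution of the
fifth-order equation (5) with nonvanishing `w = u''' + 6(u')² − t/4` to a solution of
system (6). -/
theorem stmt_3 (I : Set ℝ) (hIopen : IsOpen I) (hIconn : I.OrdConnected) (α₂ : ℂ)
    (u u1 u2 u3 u4 u5 : ℝ → ℂ)
    (hd1 : ∀ t ∈ I, HasDerivAt u (u1 t) t)
    (hd2 : ∀ t ∈ I, HasDerivAt u1 (u2 t) t)
    (hd3 : ∀ t ∈ I, HasDerivAt u2 (u3 t) t)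
    (hd4 : ∀ t ∈ I, HasDerivAt u3 (u4 t) t)
    (hd5 : ∀ t ∈ I, HasDerivAt u4 (u5 t) t)
    (hw : ∀ t ∈ I, u3 t + 6 * (u1 t) ^ 2 - (t : ℂ) / 4 ≠ 0)
    (heq : ∀ t ∈ I, u5 t =
      ((1 - α₂) * α₂ - 2 * u1 t * (24 * (u1 t) ^ 2 - (t : ℂ)) ^ 2
        - 24 * u2 t * (u1 t - (t : ℂ) * u2 t)
        + 8 * u3 t * (5 * u1 t * ((t : ℂ) - 24 * (u1 t) ^ 2)
          - 12 * (u2 t) ^ 2 - 16 * u1 t * u3 t)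
        + 2 * u4 t * (48 * u1 t * u2 t + 2 * u4 t - 1))
      / (48 * (u1 t) ^ 2 + 8 * u3 t - 2 * (t : ℂ))) :
    IsSolSystem6 I α₂ u u1 u2
      (fun t => u3 t + 6 * (u1 t) ^ 2 - (t : ℂ) / 4)
      (fun t => (u4 t - (α₂ - 24 * u1 t * u2 t) / 2)
        / (u3 t + 6 * (u1 t) ^ 2 - (t : ℂ) / 4)) := by
  intro t ht
  have hw₀ := hw t ht
  have hden : 48 * u1 t ^ 2 + 8 * u3 t - 2 * (t : ℂ) ≠ 0 := by
    rw [show 48 * u1 t ^ 2 + 8 * u3 t - 2 * (t : ℂ)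
      = 8 * (u3 t + 6 * u1 t ^ 2 - (t : ℂ) / 4) by ring]
    exact mul_ne_zero (by norm_num) hw₀
  have hu5 := (eq_div_iff hden).mp (heq t ht)
  have hderivw : HasDerivAt (fun s : ℝ => u3 s + 6 * (u1 s) ^ 2 - (s : ℂ) / 4)
      (u4 t + 12 * u1 t * u2 t - 1 / 4) t := by
    refine (((hd4 t ht).add (((hd2 t ht).pow 2).const_mul 6)).sub
      ((HasDerivAt.ofReal_comp (hasDerivAt_id t)).div_const 4)).congr_deriv ?_
    push_cast
    ring
  have hderivN : HasDerivAt (fun s => u4 s - (α₂ - 24 * u1 s * u2 s) / 2)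
      (u5 t + 12 * u2 t ^ 2 + 12 * u1 t * u3 t) t := by
    refine ((hd5 t ht).sub (((((hd2 t ht).const_mul 24).mul (hd3 t ht)).const_sub α₂).div_const
      2)).congr_deriv ?_
    ring
  refine ⟨hd1 t ht, hd2 t ht, (hd3 t ht).congr_deriv ?_, hderivw.congr_deriv ?_,
    (hderivN.div hderivw hw₀).congr_deriv ?_⟩
  · ring
  · rw [mul_div_cancel₀ _ hw₀]
    ring
  · have hq := div_mul_cancel₀ (u4 t - (α₂ - 24 * u1 t * u2 t) / 2) hw₀
    rw [div_eq_iff (pow_ne_zero 2 hw₀)]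
    beta_reduce
    generalize (u4 t - (α₂ - 24 * u1 t * u2 t) / 2)
      / (u3 t + 6 * u1 t ^ 2 - (t : ℂ) / 4) = Q at hq ⊢
    linear_combination hu5 / 8 + (Q * (u3 t + 6 * u1 t ^ 2 - (t : ℂ) / 4)
      + (u4 t - (α₂ - 24 * u1 t * u2 t) / 2)) / 2 * hq
end

section
/- Let I ⊆ ℝ be an open interval, α₂ ∈ ℂ, and let (x,y,z,w,q) be a solution of system (6) on I with parameter α₂ such that w(t) ≠ 0 for all t ∈ I. Then u := x is five times differentiable on I, one has 48(u')² + 8u''' − 2t = 8w ≠ 0 on I, and u satisfies equation (5): u''''' = [(1−α₂)α₂ − 2u'(24(u')² − t)² − 24u''(u' − t·u'') + 8u'''(5u'(t − 24(u')²) − 12(u'')² − 16u'u''') + 2u''''(48u'u'' + 2u'''' − 1)] / (48(u')² + 8u''' − 2t) for all t ∈ I. -/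
/-- conversely, from a solution of system (6) with nonvanishing `w`,
the function `u := x` is five times differentiable and solves equation (5). -/
theorem stmt_4 (I : Set ℝ) (hIopen : IsOpen I) (hIconn : I.OrdConnected) (α₂ : ℂ)
    (x y z w q : ℝ → ℂ)
    (hsol : IsSolSystem6 I α₂ x y z w q)
    (hw : ∀ t ∈ I, w t ≠ 0) :
    ∃ u1 u2 u3 u4 u5 : ℝ → ℂ,
      (∀ t ∈ I, HasDerivAt x (u1 t) t) ∧
      (∀ t ∈ I, HasDerivAt u1 (u2 t) t) ∧
      (∀ t ∈ I, HasDerivAt u2 (u3 t) t) ∧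
      (∀ t ∈ I, HasDerivAt u3 (u4 t) t) ∧
      (∀ t ∈ I, HasDerivAt u4 (u5 t) t) ∧
      (∀ t ∈ I, 48 * (u1 t) ^ 2 + 8 * u3 t - 2 * (t : ℂ) = 8 * w t) ∧
      (∀ t ∈ I, 48 * (u1 t) ^ 2 + 8 * u3 t - 2 * (t : ℂ) ≠ 0) ∧
      (∀ t ∈ I, u5 t =
        ((1 - α₂) * α₂ - 2 * u1 t * (24 * (u1 t) ^ 2 - (t : ℂ)) ^ 2
          - 24 * u2 t * (u1 t - (t : ℂ) * u2 t)
          + 8 * u3 t * (5 * u1 t * ((t : ℂ) - 24 * (u1 t) ^ 2)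
            - 12 * (u2 t) ^ 2 - 16 * u1 t * u3 t)
          + 2 * u4 t * (48 * u1 t * u2 t + 2 * u4 t - 1))
        / (48 * (u1 t) ^ 2 + 8 * u3 t - 2 * (t : ℂ))) := by
  have ht (t : ℝ) : HasDerivAt (fun s : ℝ => (s : ℂ) / 4) (1 / 4) t :=
    (HasDerivAt.ofReal_comp (hasDerivAt_id t)).div_const 4 |>.congr_deriv (by simp)
  have hu3 : ∀ t, 48 * (y t) ^ 2 + 8 * (-6 * (y t) ^ 2 + w t + (t : ℂ) / 4) - 2 * (t : ℂ)
      = 8 * w t := fun t => by ring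
  refine ⟨y, z, fun t => -6 * (y t) ^ 2 + w t + (t : ℂ) / 4,
    fun t => -12 * (y t * z t) + w t * q t + α₂ / 2,
    fun t => -12 * (z t) ^ 2 - 12 * y t * (-6 * (y t) ^ 2 + w t + (t : ℂ) / 4)
      + w t * (q t) ^ 2 / 2 + (2 * α₂ - 1) / 4 * q t - 4 * w t * y t,
    fun t h => (hsol t h).1, fun t h => (hsol t h).2.1, fun t h => (hsol t h).2.2.1,
    fun t h => ?_, fun t h => ?_, fun t _ => hu3 t, fun t h => ?_, fun t h => ?_⟩
  · obtain ⟨-, hy, -, hw', -⟩ := hsol t h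
    exact ((((hy.fun_pow 2).const_mul (-6)).fun_add hw').fun_add (ht t)).congr_deriv
      (by push_cast; ring)
  · obtain ⟨-, hy, hz, hw', hq⟩ := hsol t h
    exact ((((hy.fun_mul hz).const_mul (-12)).fun_add (hw'.fun_mul hq)).add_const
      (α₂ / 2)).congr_deriv (by ring)
  · simpa only [hu3] using mul_ne_zero (by norm_num) (hw t h)
  · simp only [hu3]
    rw [eq_div_iff (mul_ne_zero (by norm_num) (hw t h))]
    ring
end

section
/- (Bäcklund transformation s₀ of system (3).) Let I ⊆ ℝ be an open interval, α₂ ∈ ℂ, and let (q₁,p₁,q₂,p₂) be a solution of system (3) on I with parameter α₂ such that p₁(t) ≠ 0 for all t ∈ I. Then (q₁ + (1/2 − α₂)/p₁, p₁, q₂, p₂) is a solution of system (3) on I with parameter 1 − α₂. -/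
/-- the Bäcklund transformation `s₀` maps solutions of system (3) with
parameter `α₂` and nonvanishing `p₁` to solutions with parameter `1 − α₂`. -/
theorem stmt_5 (I : Set ℝ) (hIopen : IsOpen I) (hIconn : I.OrdConnected) (α₂ : ℂ)
    (q₁ p₁ q₂ p₂ : ℝ → ℂ)
    (hsol : IsSolSystem3 I α₂ q₁ p₁ q₂ p₂)
    (hp₁ : ∀ t ∈ I, p₁ t ≠ 0) :
    IsSolSystem3 I (1 - α₂)
      (fun t => q₁ t + (1 / 2 - α₂) / p₁ t) p₁ q₂ p₂ := by
  intro t ht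
  obtain ⟨hq₁, hp₁', hq₂, hp₂⟩ := hsol t ht
  have hne := hp₁ t ht
  refine ⟨?_, ?_, hq₂, hp₂⟩
  · refine (hq₁.fun_add ((hasDerivAt_const t (1 / 2 - α₂)).fun_div hp₁' hne)).congr_deriv ?_
    field_simp
    ring
  · refine hp₁'.congr_deriv ?_
    field_simp
    ring
end

section
/- (Bäcklund transformation π of system (3).) Let I ⊆ ℝ be an open interval, α₂ ∈ ℂ, and let (q₁,p₁,q₂,p₂) be a solution of system (3) on I with parameter α₂. Then the quadruple (−q₁, −(p₁ + t − 2p₂² + 4q₁(q₂ + q₁p₂)), −(q₂ + 4q₁(q₁² + p₂)), −(p₂ + 2q₁²)) is a solution of system (3) on I with parameter −α₂. -/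
/-- the Bäcklund transformation `π` maps solutions of system (3) with
parameter `α₂` to solutions with parameter `−α₂`. -/
theorem stmt_7 (I : Set ℝ) (hIopen : IsOpen I) (hIconn : I.OrdConnected) (α₂ : ℂ)
    (q₁ p₁ q₂ p₂ : ℝ → ℂ)
    (hsol : IsSolSystem3 I α₂ q₁ p₁ q₂ p₂) :
    IsSolSystem3 I (-α₂)
      (fun t => -q₁ t)
      (fun t => -(p₁ t + (t : ℂ) - 2 * (p₂ t) ^ 2 + 4 * q₁ t * (q₂ t + q₁ t * p₂ t)))
      (fun t => -(q₂ t + 4 * q₁ t * ((q₁ t) ^ 2 + p₂ t)))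
      (fun t => -(p₂ t + 2 * (q₁ t) ^ 2)) := by
  intro t ht
  obtain ⟨h₁, k₁, h₂, k₂⟩ := hsol t ht
  have hid : HasDerivAt (fun s : ℝ => (s : ℂ)) 1 t := Complex.ofRealCLM.hasDerivAt
  refine ⟨?_, ?_, ?_, ?_⟩
  · exact h₁.fun_neg.congr_deriv (by ring)
  · exact (((k₁.fun_add hid).fun_sub ((k₂.fun_pow 2).const_mul 2)).fun_add
      ((h₁.const_mul 4).fun_mul (h₂.fun_add (h₁.fun_mul k₂)))).fun_neg.congr_deriv
        (by norm_num; ring)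
  · exact (h₂.fun_add ((h₁.const_mul 4).fun_mul ((h₁.fun_pow 2).fun_add k₂))).fun_neg.congr_deriv
      (by norm_num; ring)
  · exact (k₂.fun_add ((h₁.fun_pow 2).const_mul 2)).fun_neg.congr_deriv (by norm_num; ring)
end

section
/- (Translation operator T₁ shifting α₂ by +1.) Let I ⊆ ℝ be an open interval, α₂ ∈ ℂ, and let (q₁,p₁,q₂,p₂) be a solution of system (3) on I with parameter α₂. Set f := p₁ + t − 2p₂² + 4q₁(q₂ + q₁p₂) and assume f(t) ≠ 0 for all t ∈ I. Then the quadruple (−q₁ − (2α₂+1)/(2f), −f, −(q₂ + 4q₁(q₁² + p₂)), −(p₂ + 2q₁²)), obtained by applying first the Bäcklund transformation π and then s₀, is a solution of system (3) on I with parameter α₂ + 1. -/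
/-- The Bäcklund transformation `s₀` maps solutions of system (3) with parameter `α₂` and
nonvanishing `p₁` to solutions with parameter `1 - α₂`. -/
theorem IsSolSystem3.backlund_s₀ {I : Set ℝ} {α₂ : ℂ} {q₁ p₁ q₂ p₂ : ℝ → ℂ}
    (hsol : IsSolSystem3 I α₂ q₁ p₁ q₂ p₂) (hp₁ : ∀ t ∈ I, p₁ t ≠ 0) :
    IsSolSystem3 I (1 - α₂) (fun t => q₁ t + (1 / 2 - α₂) / p₁ t) p₁ q₂ p₂ := by
  intro t ht
  obtain ⟨hq₁, hp₁', hq₂, hp₂⟩ := hsol t ht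
  have hne := hp₁ t ht
  refine ⟨?_, ?_, hq₂, hp₂⟩
  · refine (hq₁.fun_add ((hasDerivAt_const t (1 / 2 - α₂)).fun_div hp₁' hne)).congr_deriv ?_
    field_simp
    ring
  · refine hp₁'.congr_deriv ?_
    field_simp
    ring

/-- The Bäcklund transformation `π` maps solutions of system (3) with parameter `α₂` to
solutions with parameter `-α₂`. -/
theorem IsSolSystem3.backlund_π {I : Set ℝ} {α₂ : ℂ} {q₁ p₁ q₂ p₂ : ℝ → ℂ}
    (hsol : IsSolSystem3 I α₂ q₁ p₁ q₂ p₂) :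
    IsSolSystem3 I (-α₂) (fun t => -q₁ t)
      (fun t => -(p₁ t + (t : ℂ) - 2 * (p₂ t) ^ 2 + 4 * q₁ t * (q₂ t + q₁ t * p₂ t)))
      (fun t => -(q₂ t + 4 * q₁ t * ((q₁ t) ^ 2 + p₂ t)))
      (fun t => -(p₂ t + 2 * (q₁ t) ^ 2)) := by
  intro t ht
  obtain ⟨hq₁, hp₁, hq₂, hp₂⟩ := hsol t ht
  have hid : HasDerivAt (fun s : ℝ => (s : ℂ)) 1 t := Complex.ofRealCLM.hasDerivAt
  refine ⟨?_, ?_, ?_, ?_⟩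
  · refine hq₁.fun_neg.congr_deriv ?_
    ring
  · refine (((hp₁.fun_add hid).fun_sub ((hp₂.fun_pow 2).const_mul 2)).fun_add
      ((hq₁.const_mul 4).fun_mul (hq₂.fun_add (hq₁.fun_mul hp₂)))).fun_neg.congr_deriv ?_
    ring
  · refine (hq₂.fun_add
      ((hq₁.const_mul 4).fun_mul ((hq₁.fun_pow 2).fun_add hp₂))).fun_neg.congr_deriv ?_
    ring
  · refine (hp₂.fun_add ((hq₁.fun_pow 2).const_mul 2)).fun_neg.congr_deriv ?_
    ring

/-- the translation operator `T₁ = π ∘ s₀` maps solutions of system (3)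
with parameter `α₂` and nonvanishing `f = p₁ + t − 2p₂² + 4q₁(q₂ + q₁p₂)` to
solutions with parameter `α₂ + 1`. -/
theorem stmt_8 (I : Set ℝ) (hIopen : IsOpen I) (hIconn : I.OrdConnected) (α₂ : ℂ)
    (q₁ p₁ q₂ p₂ f : ℝ → ℂ)
    (hsol : IsSolSystem3 I α₂ q₁ p₁ q₂ p₂)
    (hf : ∀ t, f t = p₁ t + (t : ℂ) - 2 * (p₂ t) ^ 2 + 4 * q₁ t * (q₂ t + q₁ t * p₂ t))
    (hfne : ∀ t ∈ I, f t ≠ 0) :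
    IsSolSystem3 I (α₂ + 1)
      (fun t => -q₁ t - (2 * α₂ + 1) / (2 * f t))
      (fun t => -f t)
      (fun t => -(q₂ t + 4 * q₁ t * ((q₁ t) ^ 2 + p₂ t)))
      (fun t => -(p₂ t + 2 * (q₁ t) ^ 2)) := by
  obtain rfl : f = fun t =>
      p₁ t + (t : ℂ) - 2 * (p₂ t) ^ 2 + 4 * q₁ t * (q₂ t + q₁ t * p₂ t) := funext hf
  have h := hsol.backlund_π.backlund_s₀ fun t ht => neg_ne_zero.mpr (hfne t ht)
  convert h using 1
  · ring
  · funext t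
    rw [div_neg, ← sub_eq_add_neg, show 2 * α₂ + 1 = 2 * (1 / 2 - -α₂) by ring,
      mul_div_mul_left _ _ two_ne_zero]
end

section
/- (Translation operator T₂ shifting α₂ by −1.) Let I ⊆ ℝ be an open interval, α₂ ∈ ℂ, and let (q₁,p₁,q₂,p₂) be a solution of system (3) on I with parameter α₂ such that p₁(t) ≠ 0 for all t ∈ I. Set Q := q₁ + (1/2 − α₂)/p₁. Then the quadruple (−Q, −(p₁ + t − 2p₂² + 4Q(q₂ + Q·p₂)), −(q₂ + 4Q(Q² + p₂)), −(p₂ + 2Q²)), obtained by applying first the Bäcklund transformation s₀ and then π, is a solution of system (3) on I with parameter α₂ − 1. -/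
namespace IsSolSystem3

variable {I : Set ℝ} {α₂ : ℂ} {q₁ p₁ q₂ p₂ : ℝ → ℂ}

/-- The Bäcklund transformation `s₀`. -/
theorem backlund_s₀_s9 (h : IsSolSystem3 I α₂ q₁ p₁ q₂ p₂) (hp₁ : ∀ t ∈ I, p₁ t ≠ 0) :
    IsSolSystem3 I (1 - α₂) (fun t => q₁ t + (1 / 2 - α₂) / p₁ t) p₁ q₂ p₂ := by
  intro t ht
  obtain ⟨hq₁, hdp₁, hq₂, hp₂⟩ := h t ht
  have hne := hp₁ t ht
  refine ⟨?_, ?_, hq₂, hp₂⟩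
  · refine HasDerivAt.congr_deriv (hq₁.add ((hasDerivAt_const t (1 / 2 - α₂)).div hdp₁ hne)) ?_
    field_simp
    ring
  · refine HasDerivAt.congr_deriv hdp₁ ?_
    field_simp
    ring

/-- The Bäcklund transformation `π`. -/
theorem backlund_pi (h : IsSolSystem3 I α₂ q₁ p₁ q₂ p₂) :
    IsSolSystem3 I (-α₂)
      (fun t => -q₁ t)
      (fun t => -(p₁ t + (t : ℂ) - 2 * (p₂ t) ^ 2 + 4 * q₁ t * (q₂ t + q₁ t * p₂ t)))
      (fun t => -(q₂ t + 4 * q₁ t * ((q₁ t) ^ 2 + p₂ t)))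
      (fun t => -(p₂ t + 2 * (q₁ t) ^ 2)) := by
  intro t ht
  obtain ⟨hq₁, hp₁, hq₂, hp₂⟩ := h t ht
  have hid : HasDerivAt (fun s : ℝ => (s : ℂ)) 1 t := Complex.ofRealCLM.hasDerivAt
  refine ⟨?_, ?_, ?_, ?_⟩
  · refine HasDerivAt.congr_deriv hq₁.neg ?_
    ring
  · refine HasDerivAt.congr_deriv (((hp₁.add hid).sub ((hp₂.pow 2).const_mul 2)).add
      ((hq₁.const_mul 4).mul (hq₂.add (hq₁.mul hp₂)))).neg ?_
    simp
    ring
  · refine HasDerivAt.congr_deriv (hq₂.add ((hq₁.const_mul 4).mul ((hq₁.pow 2).add hp₂))).neg ?_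
    simp
    ring
  · refine HasDerivAt.congr_deriv (hp₂.add ((hq₁.pow 2).const_mul 2)).neg ?_
    simp
    ring

end IsSolSystem3

/-- the translation operator `T₂ = s₀ ∘ π` (applying first `s₀`, then
`π`) maps solutions of system (3) with parameter `α₂` and nonvanishing `p₁` to
solutions with parameter `α₂ − 1`, where `Q = q₁ + (1/2 − α₂)/p₁`. -/
theorem stmt_9 (I : Set ℝ) (hIopen : IsOpen I) (hIconn : I.OrdConnected) (α₂ : ℂ)
    (q₁ p₁ q₂ p₂ Q : ℝ → ℂ)
    (hsol : IsSolSystem3 I α₂ q₁ p₁ q₂ p₂)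
    (hp₁ : ∀ t ∈ I, p₁ t ≠ 0)
    (hQ : ∀ t, Q t = q₁ t + (1 / 2 - α₂) / p₁ t) :
    IsSolSystem3 I (α₂ - 1)
      (fun t => -Q t)
      (fun t => -(p₁ t + (t : ℂ) - 2 * (p₂ t) ^ 2 + 4 * Q t * (q₂ t + Q t * p₂ t)))
      (fun t => -(q₂ t + 4 * Q t * ((Q t) ^ 2 + p₂ t)))
      (fun t => -(p₂ t + 2 * (Q t) ^ 2)) := by
  obtain rfl : Q = fun t => q₁ t + (1 / 2 - α₂) / p₁ t := funext hQ
  rw [← neg_sub]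
  exact (hsol.backlund_s₀_s9 hp₁).backlund_pi
end

section
/- (Rational solution of system (3) for α₂ = −2.) Let I ⊆ ℝ be an open interval with 0 ∉ I. Then for the parameter value α₂ = −2, the quadruple (q₁,p₁,q₂,p₂)(t) = (2/t, 72/t⁴ − t/2, 12/t³, −6/t²) is a solution of system (3) on I: it satisfies dq₁/dt = q₁² + p₂, dp₁/dt = −2q₁p₁ − 5/2, dq₂/dt = −3p₂² + p₁ + t/2, dp₂/dt = q₂ for all t ∈ I. -/
/-- The derivative of `t ↦ c / t ^ n` along the real line, with values in `ℂ`. -/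
theorem hasDerivAt_const_div_ofReal_pow (c : ℂ) (n : ℕ) {t : ℝ} (ht : (t : ℂ) ≠ 0) :
    HasDerivAt (fun s : ℝ => c / (s : ℂ) ^ n) (-(n * c) / (t : ℂ) ^ (n + 1)) t := by
  have h := ((hasDerivAt_const (t : ℂ) c).div (hasDerivAt_pow n (t : ℂ))
    (pow_ne_zero n ht)).comp_ofReal
  refine h.congr_deriv ?_
  rcases n with _ | n
  · simp
  · simp only [Nat.add_sub_cancel]
    field_simp
    ring

/-- the rational solution of system (3) for `α₂ = −2`:
`(q₁,p₁,q₂,p₂) = (2/t, 72/t⁴ − t/2, 12/t³, −6/t²)` on an open interval not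
containing `0`. -/
theorem stmt_11 (I : Set ℝ) (hIopen : IsOpen I) (hIconn : I.OrdConnected)
    (h0 : (0 : ℝ) ∉ I) :
    IsSolSystem3 I (-2)
      (fun t => 2 / (t : ℂ))
      (fun t => 72 / (t : ℂ) ^ 4 - (t : ℂ) / 2)
      (fun t => 12 / (t : ℂ) ^ 3)
      (fun t => -6 / (t : ℂ) ^ 2) := by
  intro t ht
  have ht0 : (t : ℂ) ≠ 0 := by
    rintro h
    exact h0 (Complex.ofReal_eq_zero.mp h ▸ ht)
  refine ⟨?_, ?_, ?_, ?_⟩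
  · have h := hasDerivAt_const_div_ofReal_pow 2 1 ht0
    simp only [pow_one] at h
    refine h.congr_deriv ?_
    field_simp
    norm_num
    ring
  · have h := (hasDerivAt_const_div_ofReal_pow 72 4 ht0).sub
      ((hasDerivAt_id (t : ℂ)).comp_ofReal.div_const 2)
    refine h.congr_deriv ?_
    field_simp
    norm_num
    ring
  · refine (hasDerivAt_const_div_ofReal_pow 12 3 ht0).congr_deriv ?_
    field_simp
    norm_num
    ring
  · refine (hasDerivAt_const_div_ofReal_pow (-6) 2 ht0).congr_deriv ?_
    norm_num
end

section
/- (Rational solution of system (3) for α₂ = −3.) Let I ⊆ ℝ be an open interval on which t ≠ 0 and t⁵ − 144 ≠ 0. Then for the parameter value α₂ = −3, the quadruple (q₁,p₁,q₂,p₂)(t) = (3(t⁵+96)/(t(t⁵−144)), −t(t¹⁰ − 1008t⁵ − 48384)/(2(t⁵−144)²), 24(t¹⁵ + 2088t¹⁰ + 114048t⁵ − 497664)/(t³(t⁵−144)³), −12(t¹⁰ + 432t⁵ + 3456)/(t²(t⁵−144)²)) is a solution of system (3) on I: it satisfies dq₁/dt = q₁² + p₂, dp₁/dt = −2q₁p₁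 − 7/2, dq₂/dt = −3p₂² + p₁ + t/2, dp₂/dt = q₂ for all t ∈ I. -/
/-- the rational solution of system (3) for `α₂ = −3` on an open
interval where `t ≠ 0` and `t⁵ − 144 ≠ 0`. -/
theorem stmt_12 (I : Set ℝ) (hIopen : IsOpen I) (hIconn : I.OrdConnected)
    (hne : ∀ t ∈ I, t ≠ 0 ∧ t ^ 5 - 144 ≠ 0) :
    IsSolSystem3 I (-3)
      (fun t => 3 * ((t : ℂ) ^ 5 + 96) / ((t : ℂ) * ((t : ℂ) ^ 5 - 144)))
      (fun t => -((t : ℂ) * ((t : ℂ) ^ 10 - 1008 * (t : ℂ) ^ 5 - 48384))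
        / (2 * ((t : ℂ) ^ 5 - 144) ^ 2))
      (fun t => 24 * ((t : ℂ) ^ 15 + 2088 * (t : ℂ) ^ 10 + 114048 * (t : ℂ) ^ 5 - 497664)
        / ((t : ℂ) ^ 3 * ((t : ℂ) ^ 5 - 144) ^ 3))
      (fun t => -12 * ((t : ℂ) ^ 10 + 432 * (t : ℂ) ^ 5 + 3456)
        / ((t : ℂ) ^ 2 * ((t : ℂ) ^ 5 - 144) ^ 2)) := by
  intro t ht
  obtain ⟨ht0, ht5⟩ := hne t ht
  have h0 : (t : ℂ) ≠ 0 := by exact_mod_cast ht0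
  have h5 : (t : ℂ) ^ 5 - 144 ≠ 0 := by exact_mod_cast ht5
  have hid : HasDerivAt (fun s : ℝ => (s : ℂ)) 1 t := Complex.ofRealCLM.hasDerivAt
  have hu : HasDerivAt (fun s : ℝ => (s : ℂ) ^ 5 - 144) _ t := (hid.fun_pow 5).sub_const 144
  refine ⟨?_, ?_, ?_, ?_⟩
  · refine ((((hid.fun_pow 5).add_const 96).const_mul 3).fun_div (hid.fun_mul hu)
      (mul_ne_zero h0 h5)).congr_deriv ?_
    push_cast
    field_simp
    ring
  · refine ((hid.fun_mul (((hid.fun_pow 10).fun_sub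
      ((hid.fun_pow 5).const_mul 1008)).sub_const 48384)).fun_neg.fun_div
      ((hu.fun_pow 2).const_mul 2) (mul_ne_zero two_ne_zero (pow_ne_zero 2 h5))).congr_deriv ?_
    push_cast
    field_simp
    ring
  · refine ((((((hid.fun_pow 15).fun_add ((hid.fun_pow 10).const_mul 2088)).fun_add
      ((hid.fun_pow 5).const_mul 114048)).sub_const 497664).const_mul 24).fun_div
      ((hid.fun_pow 3).fun_mul (hu.fun_pow 3))
      (mul_ne_zero (pow_ne_zero 3 h0) (pow_ne_zero 3 h5))).congr_deriv ?_
    push_cast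
    field_simp
    ring
  · refine (((((hid.fun_pow 10).fun_add ((hid.fun_pow 5).const_mul 432)).add_const
      3456).const_mul (-12)).fun_div ((hid.fun_pow 2).fun_mul (hu.fun_pow 2))
      (mul_ne_zero (pow_ne_zero 2 h0) (pow_ne_zero 2 h5))).congr_deriv ?_
    push_cast
    field_simp
    ring
end

section
/- (The transformation r₁ maps system (3) to system (10).) Let I ⊆ ℝ be an open interval, α₂ ∈ ℂ, and let (q₁,p₁,q₂,p₂) be a solution of system (3) on I with parameter α₂ such that q₁(t) ≠ 0 for all t ∈ I. Define x₁ := 1/q₁, y₁ := −(q₁p₁ + 1/2 − α₂)q₁, z₁ := q₂, w₁ := p₂. Then (x₁,y₁,z₁,w₁) is a solution of system (10) on I with the same parameter α₂: dx₁/dt = −x₁²w₁ − 1, dy₁/dt = 2x₁y₁w₁ + (1/2 − α₂)w₁, dz₁/dt = −3w₁² + t/2 − x₁²y₁ − (1/2 − α₂)x₁, dw₁/dt = z₁. -/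
/-- `(q₁,p₁,q₂,p₂)` is a solution of system (10) with parameter `α₂` on `I ⊆ ℝ`:
`dq₁/dt = −q₁²p₂ − 1`, `dp₁/dt = 2q₁p₁p₂ + (1/2 − α₂)p₂`,
`dq₂/dt = −3p₂² + t/2 − q₁²p₁ − (1/2 − α₂)q₁`, `dp₂/dt = q₂`. -/
def IsSolSystem10 (I : Set ℝ) (α₂ : ℂ) (q₁ p₁ q₂ p₂ : ℝ → ℂ) : Prop :=
  ∀ t ∈ I,
    HasDerivAt q₁ (-(q₁ t) ^ 2 * p₂ t - 1) t ∧
    HasDerivAt p₁ (2 * q₁ t * p₁ t * p₂ t + (1 / 2 - α₂) * p₂ t) t ∧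
    HasDerivAt q₂ (-3 * (p₂ t) ^ 2 + (t : ℂ) / 2 - (q₁ t) ^ 2 * p₁ t - (1 / 2 - α₂) * q₁ t) t ∧
    HasDerivAt p₂ (q₂ t) t

/-- the birational symplectic transformation `r₁` takes a solution of
system (3) with nonvanishing `q₁` to a solution of system (10) with the same
parameter `α₂`. -/
theorem stmt_14 (I : Set ℝ) (hIopen : IsOpen I) (hIconn : I.OrdConnected) (α₂ : ℂ)
    (q₁ p₁ q₂ p₂ : ℝ → ℂ)
    (hsol : IsSolSystem3 I α₂ q₁ p₁ q₂ p₂)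
    (hq₁ : ∀ t ∈ I, q₁ t ≠ 0) :
    IsSolSystem10 I α₂
      (fun t => 1 / q₁ t)
      (fun t => -(q₁ t * p₁ t + 1 / 2 - α₂) * q₁ t)
      q₂ p₂ := by
  intro t ht
  obtain ⟨h₁, h₂, h₃, h₄⟩ := hsol t ht
  have hq := hq₁ t ht
  refine ⟨?_, ?_, ?_, h₄⟩
  · simp only [one_div]
    refine (h₁.fun_inv hq).congr_deriv ?_
    field_simp
    ring
  · refine ((((h₁.fun_mul h₂).add_const (1 / 2 : ℂ)).sub_const α₂).fun_neg.fun_mul h₁).congr_deriv ?_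
    field_simp
    ring
  · refine h₃.congr_deriv ?_
    field_simp
    ring
end

section
/- (Bäcklund transformation s₀ of system (6).) Let I ⊆ ℝ be an open interval, α₂ ∈ ℂ, and let (x,y,z,w,q) be a solution of system (6) on I with parameter α₂ such that w(t) ≠ 0 for all t ∈ I. Then (x, y, z, w, q + (α₂ − 1/2)/w) is a solution of system (6) on I with parameter 1 − α₂. -/
/-- the Bäcklund transformation `s₀` maps solutions of system (6)
with parameter `α₂` and nonvanishing `w` to solutions with parameter `1 − α₂`. -/
theorem stmt_17 (I : Set ℝ) (hIopen : IsOpen I) (hIconn : I.OrdConnected) (α₂ : ℂ)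
    (x y z w q : ℝ → ℂ)
    (hsol : IsSolSystem6 I α₂ x y z w q)
    (hw : ∀ t ∈ I, w t ≠ 0) :
    IsSolSystem6 I (1 - α₂) x y z w
      (fun t => q t + (α₂ - 1 / 2) / w t) := by
  intro t ht
  obtain ⟨hx, hy, hz, hw', hq⟩ := hsol t ht
  have hwt := hw t ht
  refine ⟨hx, hy, hz, hw'.congr_deriv ?_,
    (hq.add ((hasDerivAt_const t (α₂ - 1 / 2)).div hw' hwt)).congr_deriv ?_⟩
  · field_simp
    ring
  · field_simp
    ring
end

section
/- (Bäcklund transformation π of system (6).) Let I ⊆ ℝ be an open interval, α₂ ∈ ℂ, and let (x,y,z,w,q) be a solution of system (6) on I with parameter α₂. Then the quintuple (x + q/2, −(y + q²/4), −(z − q(q² + 8y)/4), −(w + yq² − 4y² − 2zq + t/2), −q) is a solution of system (6) on I with parameter −α₂. -/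
/-- the Bäcklund transformation `π` maps solutions of system (6)
with parameter `α₂` to solutions with parameter `−α₂`. -/
theorem stmt_18 (I : Set ℝ) (hIopen : IsOpen I) (hIconn : I.OrdConnected) (α₂ : ℂ)
    (x y z w q : ℝ → ℂ)
    (hsol : IsSolSystem6 I α₂ x y z w q) :
    IsSolSystem6 I (-α₂)
      (fun t => x t + q t / 2)
      (fun t => -(y t + (q t) ^ 2 / 4))
      (fun t => -(z t - q t * ((q t) ^ 2 + 8 * y t) / 4))
      (fun t => -(w t + y t * (q t) ^ 2 - 4 * (y t) ^ 2 - 2 * z t * q t + (t : ℂ) / 2))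
      (fun t => -q t) := by
  intro t ht
  obtain ⟨hx, hy, hz, hw, hq⟩ := hsol t ht
  have hq2 := hq.fun_pow 2
  have ht' : HasDerivAt (fun s : ℝ => (s : ℂ)) 1 t := Complex.ofRealCLM.hasDerivAt
  refine ⟨?_, ?_, ?_, ?_, ?_⟩
  · refine (hx.fun_add (hq.div_const 2)).congr_deriv ?_
    ring
  · refine (hy.fun_add (hq2.div_const 4)).fun_neg.congr_deriv ?_
    push_cast
    ring
  · refine (hz.fun_sub ((hq.fun_mul (hq2.fun_add (hy.const_mul 8))).div_const 4)).fun_neg.congr_deriv ?_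
    push_cast
    ring
  · refine ((((hw.fun_add (hy.fun_mul hq2)).fun_sub ((hy.fun_pow 2).const_mul 4)).fun_sub
      ((hz.const_mul 2).fun_mul hq)).fun_add (ht'.div_const 2)).fun_neg.congr_deriv ?_
    push_cast
    ring
  · refine hq.fun_neg.congr_deriv ?_
    ring
end
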